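/- Let A_1, A_2, A_3, A_4 be n×n quaternion Hermitian matrices and let X be an n×n quaternion Hermitian positive semidefinite matrix of rank r ≥ 1. Suppose X admits a decomposition X = Σ_{i=1}^r v_i v_iᴴ with v_iᴴ A_k v_i = (A_k • X)/r for all i = 1,…,r and k = 1, 2, 3. Then X admits a decomposition X = Σ_{i=1}^r x_i x_iᴴ with x_iᴴ A_k x_i = (A_k • X)/r for all i = 1,…,r and k = 1, 2, 3, 4. -/

import Mathlib

open Matrix Quaternion BigOperators

/-- The quadratic form `xᴴ A x` of a quaternion matrix. -/
noncomputable def qform {n : ℕ} (A : Matrix (Fin n) (Fin n) ℍ[ℝ]) (x : Fin n → ℍ[ℝ]) : ℍ[ℝ] :=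
  star x ⬝ᵥ A.mulVec x

/-- The inner product `A • B = Re (tr (Aᴴ B))` of quaternion matrices. -/
noncomputable def qdot {n : ℕ} (A B : Matrix (Fin n) (Fin n) ℍ[ℝ]) : ℝ :=
  (Matrix.trace (Aᴴ * B)).re

/-- A quaternion matrix is Hermitian positive semidefinite:
it is Hermitian and `xᴴ X x ≥ 0` for all `x`. -/
def qPSD {n : ℕ} (X : Matrix (Fin n) (Fin n) ℍ[ℝ]) : Prop :=
  X.IsHermitian ∧ ∀ x : Fin n → ℍ[ℝ], 0 ≤ (star x ⬝ᵥ X.mulVec x).re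

/-- `X` can be written as a sum of `r` quaternion rank-one outer products. -/
def qDecomp {n : ℕ} (X : Matrix (Fin n) (Fin n) ℍ[ℝ]) (r : ℕ) : Prop :=
  ∃ v : Fin r → (Fin n → ℍ[ℝ]), X = ∑ i, vecMulVec (v i) (star (v i))

/-- `X` has rank `r`: `r` is the least number of rank-one terms summing to `X`. -/
def qRank {n : ℕ} (X : Matrix (Fin n) (Fin n) ℍ[ℝ]) (r : ℕ) : Prop :=
  qDecomp X r ∧ ∀ s : ℕ, qDecomp X s → r ≤ s

/-- The real part of the sesquilinear form `xᴴ A y`, as a real bilinear form. -/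
noncomputable def qbilin {n : ℕ} (A : Matrix (Fin n) (Fin n) ℍ[ℝ]) :
    (Fin n → ℍ[ℝ]) →ₗ[ℝ] (Fin n → ℍ[ℝ]) →ₗ[ℝ] ℝ :=
  LinearMap.mk₂ ℝ (fun x y => (star x ⬝ᵥ A.mulVec y).re)
    (fun x y z => by simp [add_dotProduct])
    (fun c x y => by
      have h : star (c • x) = c • star x := funext fun k => Quaternion.star_smul c (x k)
      simp [h, smul_dotProduct])
    (fun x y z => by simp [mulVec_add, dotProduct_add])
    (fun c x y => by simp [mulVec_smul, dotProduct_smul])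

theorem qbilin_apply {n : ℕ} (A : Matrix (Fin n) (Fin n) ℍ[ℝ]) (x y : Fin n → ℍ[ℝ]) :
    qbilin A x y = (star x ⬝ᵥ A.mulVec y).re := rfl

theorem star_sesquilin {n : ℕ} {A : Matrix (Fin n) (Fin n) ℍ[ℝ]} (hA : A.IsHermitian)
    (x y : Fin n → ℍ[ℝ]) : star (star x ⬝ᵥ A.mulVec y) = star y ⬝ᵥ A.mulVec x := by
  rw [← star_dotProduct_star, star_star, star_mulVec, hA.eq, dotProduct_mulVec]

theorem qbilin_comm {n : ℕ} {A : Matrix (Fin n) (Fin n) ℍ[ℝ]} (hA : A.IsHermitian)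
    (x y : Fin n → ℍ[ℝ]) : qbilin A x y = qbilin A y x := by
  rw [qbilin_apply, qbilin_apply, ← star_sesquilin hA x y, Quaternion.re_star]

theorem qform_eq_coe_iff {n : ℕ} {A : Matrix (Fin n) (Fin n) ℍ[ℝ]} (hA : A.IsHermitian)
    (x : Fin n → ℍ[ℝ]) (d : ℝ) : qform A x = (d : ℍ[ℝ]) ↔ qbilin A x x = d := by
  have h : qform A x = ((qbilin A x x : ℝ) : ℍ[ℝ]) :=
    Quaternion.star_eq_self.mp (star_sesquilin hA x x)
  rw [h, Quaternion.coe_inj]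

theorem quaternion_re_mul_comm (a b : ℍ[ℝ]) : (a * b).re = (b * a).re := by
  simp only [Quaternion.re_mul]
  ring

theorem quaternion_re_sum {ι : Type*} [Fintype ι] (f : ι → ℍ[ℝ]) :
    (∑ k, f k).re = ∑ k, (f k).re :=
  map_sum (⟨⟨QuaternionAlgebra.re, rfl⟩, fun _ _ => rfl⟩ : ℍ[ℝ] →+ ℝ) f Finset.univ

/-- Right multiplication of a quaternion vector by a scalar, as a real linear map in the scalar. -/
noncomputable def rightScale {n : ℕ} (x : Fin n → ℍ[ℝ]) : ℍ[ℝ] →ₗ[ℝ] (Fin n → ℍ[ℝ]) where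
  toFun q := fun k => x k * q
  map_add' p q := by ext1 k; simp [mul_add]
  map_smul' c q := by ext1 k; simp

theorem qbilin_rightScale {n : ℕ} (A : Matrix (Fin n) (Fin n) ℍ[ℝ]) (x : Fin n → ℍ[ℝ])
    {q : ℍ[ℝ]} (hq : q * star q = 1) :
    qbilin A (rightScale x q) (rightScale x q) = qbilin A x x := by
  have h : star (rightScale x q) ⬝ᵥ A.mulVec (rightScale x q)
      = star q * ((star x ⬝ᵥ A.mulVec x) * q) := by
    simp [dotProduct, mulVec, rightScale, Finset.mul_sum, Finset.sum_mul, mul_assoc]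
  rw [qbilin_apply, qbilin_apply, h, quaternion_re_mul_comm, mul_assoc, hq, mul_one]

theorem vecMulVec_rightScale {n : ℕ} (x : Fin n → ℍ[ℝ]) {q : ℍ[ℝ]} (hq : q * star q = 1) :
    vecMulVec (rightScale x q) (star (rightScale x q)) = vecMulVec x (star x) := by
  ext1 k l
  simp only [vecMulVec_apply, rightScale, LinearMap.coe_mk, AddHom.coe_mk, Pi.star_apply, star_mul]
  rw [mul_assoc, ← mul_assoc q, hq, one_mul]

theorem vecMulVec_rotate {n : ℕ} (x y : Fin n → ℍ[ℝ]) {c s : ℝ} (h : c ^ 2 + s ^ 2 = 1) :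
    vecMulVec (c • x + s • y) (star (c • x + s • y))
      + vecMulVec (c • y - s • x) (star (c • y - s • x))
      = vecMulVec x (star x) + vecMulVec y (star y) := by
  ext1 k l
  simp only [vecMulVec_apply, Matrix.add_apply, Pi.star_apply, Pi.add_apply, Pi.sub_apply,
    Pi.smul_apply, star_add, star_sub, Quaternion.star_smul, add_mul, mul_add, sub_mul, mul_sub,
    smul_mul_smul_comm]
  match_scalars <;> grind

theorem qdot_vecMulVec_sum {n r : ℕ} {A : Matrix (Fin n) (Fin n) ℍ[ℝ]} (hA : A.IsHermitian)
    (v : Fin r → Fin n → ℍ[ℝ]) :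
    qdot A (∑ i, vecMulVec (v i) (star (v i))) = ∑ i, qbilin A (v i) (v i) := by
  have h (x : Fin n → ℍ[ℝ]) : (trace (A * vecMulVec x (star x))).re = qbilin A x x := by
    rw [qbilin_apply, mul_vecMulVec, trace_vecMulVec, dotProduct, dotProduct,
      quaternion_re_sum, quaternion_re_sum]
    exact Finset.sum_congr rfl fun k _ => quaternion_re_mul_comm _ _
  simp only [← h]
  rw [qdot, hA.eq, Finset.mul_sum, trace_sum, quaternion_re_sum]

/-- A unit quaternion annihilating three real bilinear cross terms. -/
theorem exists_unit_qbilin_rightScale_eq_zero {n : ℕ} (A : Fin 3 → Matrix (Fin n) (Fin n) ℍ[ℝ])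
    (x y : Fin n → ℍ[ℝ]) :
    ∃ q : ℍ[ℝ], q * star q = 1 ∧ ∀ k, qbilin (A k) x (rightScale y q) = 0 := by
  let L : ℍ[ℝ] →ₗ[ℝ] (Fin 3 → ℝ) := LinearMap.pi fun k => (qbilin (A k) x).comp (rightScale y)
  have hL : LinearMap.ker L ≠ ⊥ :=
    LinearMap.ker_ne_bot_of_finrank_lt (by simp [Quaternion.finrank_eq_four])
  obtain ⟨p, hp, hp0⟩ := Submodule.exists_mem_ne_zero_of_ne_bot hL
  refine ⟨‖p‖⁻¹ • p, ?_, fun k => ?_⟩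
  · rw [Quaternion.self_mul_star, Quaternion.normSq_eq_norm_mul_self, norm_smul]
    simp [hp0]
  · have h : qbilin (A k) x (rightScale y p) = 0 := congrFun hp k
    simp [h]

/-- Two vectors agreeing on three forms can be rotated, keeping the sum of their outer products,
so that the first one takes a prescribed intermediate value on a fourth form. -/
theorem exists_rotation {n : ℕ} (A : Fin 3 → Matrix (Fin n) (Fin n) ℍ[ℝ])
    (hA : ∀ k, (A k).IsHermitian) (B : Matrix (Fin n) (Fin n) ℍ[ℝ]) (d : Fin 3 → ℝ) (e : ℝ)
    (x y : Fin n → ℍ[ℝ]) (hx : ∀ k, qbilin (A k) x x = d k) (hy : ∀ k, qbilin (A k) y y = d k)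
    (hxe : qbilin B x x ≤ e) (hye : e ≤ qbilin B y y) :
    ∃ x' y' : Fin n → ℍ[ℝ],
      vecMulVec x' (star x') + vecMulVec y' (star y')
        = vecMulVec x (star x) + vecMulVec y (star y) ∧
      (∀ k, qbilin (A k) x' x' = d k) ∧ (∀ k, qbilin (A k) y' y' = d k) ∧
      qbilin B x' x' = e := by
  obtain ⟨q, hq, hxq⟩ := exists_unit_qbilin_rightScale_eq_zero A x y
  have hqx : ∀ k, qbilin (A k) (rightScale y q) x = 0 := fun k => by
    rw [qbilin_comm (hA k), hxq]
  rw [← vecMulVec_rightScale y hq]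
  rw [← qbilin_rightScale B y hq] at hye
  simp only [← qbilin_rightScale _ y hq] at hy
  generalize rightScale y q = w at *
  let g : ℝ → ℝ := fun t => qbilin B (Real.cos t • x + Real.sin t • w)
    (Real.cos t • x + Real.sin t • w)
  have hg : Continuous g := by
    simp only [g, map_add, map_smul, LinearMap.add_apply, LinearMap.smul_apply, smul_eq_mul]
    fun_prop
  obtain ⟨t, -, ht⟩ := intermediate_value_Icc (by positivity : (0 : ℝ) ≤ Real.pi / 2)
    hg.continuousOn (show e ∈ Set.Icc (g 0) (g (Real.pi / 2)) by simpa [g] using ⟨hxe, hye⟩)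
  have hcs := Real.cos_sq_add_sin_sq t
  refine ⟨_, _, vecMulVec_rotate x w hcs, fun k => ?_, fun k => ?_, ht⟩
  all_goals
    simp only [map_add, map_sub, map_smul, LinearMap.add_apply, LinearMap.sub_apply,
      LinearMap.smul_apply, smul_eq_mul, hx, hy, hxq, hqx]
    linear_combination d k * hcs

theorem exists_decomp_of_sum_eq {n r : ℕ} (A : Fin 3 → Matrix (Fin n) (Fin n) ℍ[ℝ])
    (hA : ∀ k, (A k).IsHermitian) (B : Matrix (Fin n) (Fin n) ℍ[ℝ]) (hB : B.IsHermitian)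
    (d : Fin 3 → ℝ) (e : ℝ) (X : Matrix (Fin n) (Fin n) ℍ[ℝ]) (hX : qdot B X = r * e) (m : ℕ)
    (v : Fin r → Fin n → ℍ[ℝ]) (hv : X = ∑ i, vecMulVec (v i) (star (v i)))
    (hd : ∀ i k, qbilin (A k) (v i) (v i) = d k)
    (hm : (Finset.univ.filter fun i => qbilin B (v i) (v i) ≠ e).card ≤ m) :
    ∃ x : Fin r → Fin n → ℍ[ℝ], X = ∑ i, vecMulVec (x i) (star (x i)) ∧
      (∀ i k, qbilin (A k) (x i) (x i) = d k) ∧ ∀ i, qbilin B (x i) (x i) = e := by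
  induction m generalizing v with
  | zero =>
    refine ⟨v, hv, hd, fun i => ?_⟩
    by_contra h
    have hi : i ∈ Finset.univ.filter fun i => qbilin B (v i) (v i) ≠ e := by simpa using h
    have := Finset.card_pos.mpr ⟨i, hi⟩
    omega
  | succ m ih =>
    by_cases hall : ∀ i, qbilin B (v i) (v i) = e
    · exact ⟨v, hv, hd, hall⟩
    have hsum : ∑ i, qbilin B (v i) (v i) = ∑ _i : Fin r, e := by
      rw [← qdot_vecMulVec_sum hB, ← hv, hX]; simp
    push Not at hall
    obtain ⟨l, hl⟩ := hall
    obtain ⟨i, hi⟩ : ∃ i, qbilin B (v i) (v i) < e := by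
      by_contra! h
      exact hl (((Finset.sum_eq_sum_iff_of_le fun i _ => h i).mp hsum.symm l (by simp)).symm)
    obtain ⟨j, hj⟩ : ∃ j, e < qbilin B (v j) (v j) := by
      by_contra! h
      exact hl ((Finset.sum_eq_sum_iff_of_le fun i _ => h i).mp hsum l (by simp))
    have hij : j ≠ i := by rintro rfl; linarith
    obtain ⟨x, y, hxy, hx, hy, hxe⟩ :=
      exists_rotation A hA B d e (v i) (v j) (hd i) (hd j) hi.le hj.le
    let w := Function.update (Function.update v i x) j y
    have hwi : w i = x := by simp [w, hij.symm]
    have hwj : w j = y := by simp [w]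
    have hw : ∀ k, k ≠ i → k ≠ j → w k = v k := fun k hki hkj => by simp [w, hki, hkj]
    refine ih w ?_ (fun k => ?_) ?_
    · have split : ∀ u : Fin r → Fin n → ℍ[ℝ], ∑ k, vecMulVec (u k) (star (u k)) =
          vecMulVec (u i) (star (u i)) + vecMulVec (u j) (star (u j))
            + ∑ k ∈ (Finset.univ.erase i).erase j, vecMulVec (u k) (star (u k)) := fun u => by
        have hj' : j ∈ Finset.univ.erase i := by simpa using hij
        rw [add_assoc, Finset.add_sum_erase _ (fun k => vecMulVec (u k) (star (u k))) hj',
          Finset.add_sum_erase _ (fun k => vecMulVec (u k) (star (u k))) (Finset.mem_univ i)]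
      rw [hv, split v, split w, hwi, hwj, hxy]
      congr 1
      refine Finset.sum_congr rfl fun k hk => ?_
      simp only [Finset.mem_erase, Finset.mem_univ, and_true] at hk
      rw [hw k hk.2 hk.1]
    · by_cases hki : k = i
      · rwa [hki, hwi]
      by_cases hkj : k = j
      · rwa [hkj, hwj]
      rw [hw k hki hkj]
      exact hd k
    · refine Nat.le_of_lt_succ (lt_of_lt_of_le (Finset.card_lt_card ?_) hm)
      refine Finset.ssubset_iff_of_subset (fun k hk => ?_) |>.mpr
        ⟨i, by simpa using hi.ne, by simpa [hwi] using hxe⟩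
      simp only [Finset.mem_filter, Finset.mem_univ, true_and] at hk ⊢
      by_cases hki : k = i
      · rw [hki, hwi] at hk
        exact absurd hxe hk
      by_cases hkj : k = j
      · rw [hkj]
        exact hj.ne'
      rwa [hw k hki hkj] at hk

/-- From a decomposition with the equal inner product property for three
matrices one can obtain one with the property for four matrices. -/
theorem quaternion_rank_one_decomposition_three_to_four {n r : ℕ} (hr : 1 ≤ r)
    (A₁ A₂ A₃ A₄ : Matrix (Fin n) (Fin n) ℍ[ℝ])
    (h₁ : A₁.IsHermitian) (h₂ : A₂.IsHermitian) (h₃ : A₃.IsHermitian)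
    (h₄ : A₄.IsHermitian)
    (X : Matrix (Fin n) (Fin n) ℍ[ℝ]) (hX : qPSD X) (hrank : qRank X r)
    (v : Fin r → (Fin n → ℍ[ℝ]))
    (hv : X = ∑ i, vecMulVec (v i) (star (v i)))
    (hvA : ∀ i : Fin r,
      qform A₁ (v i) = ((qdot A₁ X / r : ℝ) : ℍ[ℝ]) ∧
      qform A₂ (v i) = ((qdot A₂ X / r : ℝ) : ℍ[ℝ]) ∧
      qform A₃ (v i) = ((qdot A₃ X / r : ℝ) : ℍ[ℝ])) :
    ∃ x : Fin r → (Fin n → ℍ[ℝ]),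
      X = ∑ i, vecMulVec (x i) (star (x i)) ∧
      ∀ i : Fin r,
        qform A₁ (x i) = ((qdot A₁ X / r : ℝ) : ℍ[ℝ]) ∧
        qform A₂ (x i) = ((qdot A₂ X / r : ℝ) : ℍ[ℝ]) ∧
        qform A₃ (x i) = ((qdot A₃ X / r : ℝ) : ℍ[ℝ]) ∧
        qform A₄ (x i) = ((qdot A₄ X / r : ℝ) : ℍ[ℝ]) := by
  have hr0 : (r : ℝ) ≠ 0 := by exact_mod_cast (by omega : r ≠ 0)
  obtain ⟨x, hx, hxA, hxB⟩ := exists_decomp_of_sum_eq ![A₁, A₂, A₃]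
    (by simp [Fin.forall_fin_succ, h₁, h₂, h₃]) A₄ h₄
    ![qdot A₁ X / r, qdot A₂ X / r, qdot A₃ X / r] (qdot A₄ X / r) X (by field_simp) _ v hv
    (fun i => by
      have h := hvA i
      rw [qform_eq_coe_iff h₁, qform_eq_coe_iff h₂, qform_eq_coe_iff h₃] at h
      simpa [Fin.forall_fin_succ] using h) le_rfl
  refine ⟨x, hx, fun i => ⟨?_, ?_, ?_, ?_⟩⟩
  · exact (qform_eq_coe_iff h₁ _ _).mpr (hxA i 0)
  · exact (qform_eq_coe_iff h₂ _ _).mpr (hxA i 1)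
  · exact (qform_eq_coe_iff h₃ _ _).mpr (hxA i 2)
  · exact (qform_eq_coe_iff h₄ _ _).mpr (hxB i)
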